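/- Let m ≥ 2. (1) For every t ≥ 2, every base-(m+1) digit of the number of occurrences of m in T_t^(m−1) is at most m−1; equivalently, T_t^(m−1) = (B_x^(m))^{a_x}·…·(B_1^(m))^{a_1} for some digits a_1,…,a_x ∈ {0,…,m−1}. (2) Conversely, for every integer y ≥ 1 that is not divisible by m+1 and all of whose base-(m+1) digits are at most m−1, there exists t ≥ 2 such that T_t^(m−1) = π^(m)(1,y). -/

import Mathlib

open List Filter

open scoped Classical

noncomputable section

/-- The curling number of a finite string: the largest `k` such that
`S = X ++ Y^k` with `Y` nonempty; by convention `curl [] = 1`. -/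
def curl (S : List ℕ) : ℕ :=
  max 1 (sSup {k | ∃ X Y : List ℕ, Y ≠ [] ∧ S = X ++ (List.replicate k Y).flatten})

/-- The prefix of length `n` of the level-`m` Gijswijt sequence `A^(m)`. -/
def gPrefix (m : ℕ) : ℕ → List ℕ
  | 0 => []
  | n + 1 => gPrefix m n ++ [max m (curl (gPrefix m n))]

/-- `gij m p` is the `p`-th term (1-indexed) of the level-`m` Gijswijt sequence `A^(m)`. -/
def gij (m p : ℕ) : ℕ := max m (curl (gPrefix m (p - 1)))

/-- Standing hypothesis: for every `m ≥ 1`, the sets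
`{k ≥ 0 : C(A^(m)[1,k]) ≤ m}` and `{k ≥ 0 : C(A^(m+1)[1,k]) ≤ m}` are infinite. -/
def StandingHyp : Prop :=
  ∀ m : ℕ, 1 ≤ m →
    {k : ℕ | curl (gPrefix m k) ≤ m}.Infinite ∧
    {k : ℕ | curl (gPrefix (m + 1) k) ≤ m}.Infinite

/-- Length of `π^(m)(1,x)`: the `x`-th smallest (0-indexed) element of
`{k : C(A^(m)[1,k]) ≤ m}`. -/
def piLen (m x : ℕ) : ℕ := Nat.nth (fun k => curl (gPrefix m k) ≤ m) x

/-- `π^(m)(1,x)`: the prefix of `A^(m)` with exactly `x` occurrences of `m`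
and curling number at most `m`. -/
def piStr (m x : ℕ) : List ℕ := gPrefix m (piLen m x)

/-- `β^(m)(t)`, the length of `B_t^(m)`. -/
def beta (m t : ℕ) : ℕ := piLen m ((m + 1) ^ (t - 1))

/-- `B_t^(m) := π^(m)(1,(m+1)^(t-1))`. -/
def Bstr (m t : ℕ) : List ℕ := piStr m ((m + 1) ^ (t - 1))

/-- `τ^(m)(t)`, the length of `T_t^(m)`. -/
def tau (m t : ℕ) : ℕ := Nat.nth (fun k => curl (gPrefix (m + 1) k) ≤ m) (t - 1)

/-- `T_t^(m)`: the `t`-th shortest prefix of `A^(m+1)` with curling number at most `m`. -/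
def Tstr (m t : ℕ) : List ℕ := gPrefix (m + 1) (tau m t)

/-- `φ^(m)(n)`: the least `p ≥ 1` with `A^(m)(p) = n`. -/
def phi (m n : ℕ) : ℕ := sInf {p : ℕ | 1 ≤ p ∧ gij m p = n}

/-- `t^(m)(n) = 1 + log_{m+1} #\{i ≤ φ^(m)(n) : A^(m)(i) = m\}`. -/
def tfun (m n : ℕ) : ℕ := 1 + Nat.log (m + 1) ((gPrefix m (phi m n)).count m)

/-- `χ^(b)(a)`: read the base-`b` digits of `a` as base-`(b+1)` digits. -/
def chi (b a : ℕ) : ℕ := Nat.ofDigits (b + 1) (Nat.digits b a)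

/-- `ι_m(t)`: read the base-`(m+2)` digits of the number of occurrences of `m+1`
in `T_t^(m)` as base-`(m+1)` digits. -/
def iota (m t : ℕ) : ℕ :=
  Nat.ofDigits (m + 1) (Nat.digits (m + 2) ((Tstr m t).count (m + 1)))

/-- `ι_m⁻¹(p)`: the largest `x ≥ 1` with `ι_m(x) ≤ p`. -/
def iotaInv (m p : ℕ) : ℕ := sSup {x : ℕ | 1 ≤ x ∧ iota m x ≤ p}

/-- `ord_b(n)`: the `b`-adic valuation of `n`. -/
def ordb (b n : ℕ) : ℕ := sSup {z : ℕ | b ^ z ∣ n}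

/-- The largest base-`b` digit of `n`. -/
def maxdigit (b n : ℕ) : ℕ := (Nat.digits b n).foldr max 0

/-- Auxiliary function for the level-`m` expansion: `lexpAux m a k = a_{m+1+k}`. -/
def lexpAux (m a : ℕ) : ℕ → ℕ
  | 0 => a
  | k + 1 => iota (m + 1 + k) (ordb (m + 1 + k) (lexpAux m a k) + 1)

/-- `lexp m a l = a_l`, the `l`-th term of the level-`m` expansion of `a`. -/
def lexp (m a l : ℕ) : ℕ := lexpAux m a (l - (m + 1))

/-- The last element `n` of `π^(m+1)(1, χ^(m+1)(a))`; the level-`m` expansion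
of `a` is `a_{m+1}, …, a_n`. -/
def levelEnd (m a : ℕ) : ℕ := (piStr (m + 1) (chi (m + 1) a)).getLastD 0

/-- `V_m := {v ≥ 0 : C(T_{v+1}^(m+1)) ≤ m}`. -/
def Vset (m : ℕ) : Set ℕ := {v | curl (Tstr (m + 1) (v + 1)) ≤ m}

/-- `Q := {α ≥ 0 : C(T_{α+1}^(2)) = 1}`. -/
def Qset : Set ℕ := {a | curl (Tstr 2 (a + 1)) = 1}

/-- `R := {(a,b) : a ∈ Q, a < b, no suffix S of T_{a+1}^(2) with T_{a+1}^(2)·S = T_{b+1}^(2)}`. -/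
def Rset : Set (ℕ × ℕ) :=
  {p | p.1 ∈ Qset ∧ p.1 < p.2 ∧
    ¬∃ S : List ℕ, S <:+ Tstr 2 (p.1 + 1) ∧ Tstr 2 (p.1 + 1) ++ S = Tstr 2 (p.2 + 1)}

/-- The digit of `x` in base `b` at (1-indexed) position `i`, i.e. the coefficient
of `b^(i-1)`. -/
def digitAt (b x i : ℕ) : ℕ := (Nat.digits b x).getD (i - 1) 0

/-- `u` is the (1-indexed) position of the second nonzero base-`b` digit of `x`
(the first nonzero digit being at position `ord_b(x)+1`). -/
def IsSecondNonzero (b x u : ℕ) : Prop :=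
  ordb b x + 1 < u ∧ digitAt b x u ≠ 0 ∧
    ∀ i, ordb b x + 1 < i → i < u → digitAt b x i = 0

/-- `𝒮_b`: pairs `(a,a')` with `1 ≤ a < a'` such that for some position `y` the
base-`b` digits of `a` and `a'` agree away from `y` and twice the `y`-th digit of `a`
is at least the `y`-th digit of `a'`. -/
def Sset (b : ℕ) : Set (ℕ × ℕ) :=
  {p | 1 ≤ p.1 ∧ p.1 < p.2 ∧
    ∃ y : ℕ, (∀ i, i ≠ y → (Nat.digits b p.1).getD i 0 = (Nat.digits b p.2).getD i 0) ∧
      (Nat.digits b p.2).getD y 0 ≤ 2 * (Nat.digits b p.1).getD y 0}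

/-- The glue string `S_t^(m)`, so that `T_{t+1}^(m) = T_t^(m) ++ glue m t`. -/
def glue (m t : ℕ) : List ℕ := (gPrefix (m + 1) (tau m (t + 1))).drop (tau m t)

/-- The strings `P_t^(m)`: `P_1^(m) = (m)` and `P_{t+1}^(m) = P_t^(m)·B_t^(m)·S_t^(m)`. -/
def Pstr (m : ℕ) : ℕ → List ℕ
  | 0 => []
  | 1 => [m]
  | t + 2 => Pstr m (t + 1) ++ Bstr m (t + 1) ++ glue m (t + 1)

end

/-- The length-`E` prefix of `a` ends in a `k`-th power of a word of length `l`. -/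
def PowerSuffix (a : ℕ → ℕ) (E k l : ℕ) : Prop :=
  0 < l ∧ k * l ≤ E ∧ ∀ p, E ≤ p + k * l → p + l < E → a p = a (p + l)

theorem getElem?_flatten_replicate (Y : List ℕ) (k q : ℕ) (hq : q + Y.length < k * Y.length) :
    (List.replicate k Y).flatten[q]? = (List.replicate k Y).flatten[q + Y.length]? := by
  obtain _ | k := k
  · simp at hq
  · have hlen : (List.replicate k Y).flatten.length = k * Y.length := by simp
    rw [Nat.succ_mul] at hq
    have h1 : (List.replicate (k + 1) Y).flatten = (List.replicate k Y).flatten ++ Y := by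
      simp [List.replicate_succ']
    have h2 : (List.replicate (k + 1) Y).flatten = Y ++ (List.replicate k Y).flatten := by
      simp [List.replicate_succ]
    conv_lhs => rw [h1]
    rw [h2, List.getElem?_append_left (by omega), List.getElem?_append_right (by omega)]
    simp

theorem map_range_eq_flatten_replicate (f : ℕ → ℕ) (l k : ℕ)
    (hf : ∀ i, i + l < k * l → f i = f (i + l)) :
    (List.range (k * l)).map f = (List.replicate k ((List.range l).map f)).flatten := by
  induction k with
  | zero => simp
  | succ k ih =>
    have hmul : ∀ j, j ≤ k → ∀ i, i < l → f (j * l + i) = f i := by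
      intro j
      induction j with
      | zero => simp
      | succ j ihj =>
        intro hj i hi
        rw [← ihj (by omega) i hi, hf (j * l + i)]
        · congr 1; ring
        · have := Nat.mul_le_mul_right l hj
          rw [Nat.succ_mul] at this ⊢
          omega
    rw [Nat.succ_mul, List.range_add, List.map_append, ih, List.replicate_succ',
      List.flatten_append]
    · congr 1
      simp only [List.map_map, List.flatten_cons, List.flatten_nil, List.append_nil]
      exact List.map_congr_left fun i hi => hmul k le_rfl i (List.mem_range.1 hi)
    · intro i hi
      apply hf
      rw [Nat.succ_mul]
      omega

theorem eq_append_power_iff (a : ℕ → ℕ) (E k : ℕ) :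
    (∃ X Y : List ℕ, Y ≠ [] ∧
      (List.range E).map a = X ++ (List.replicate k Y).flatten) ↔
    ∃ l, PowerSuffix a E k l := by
  constructor
  · rintro ⟨X, Y, hY, h⟩
    have hlen : E = X.length + k * Y.length := by simpa using congrArg List.length h
    refine ⟨Y.length, List.length_pos_iff.2 hY, by omega, fun p hp hp' => ?_⟩
    have key := getElem?_flatten_replicate Y k (p - X.length) (by omega)
    have e1 : ∀ q, X.length ≤ q → q < E →
        some (a q) = (List.replicate k Y).flatten[q - X.length]? := by
      intro q hq hq'
      rw [← List.getElem?_append_right hq, ← h]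
      simp [hq']
    have h1 := e1 p (by omega) (by omega)
    have h2 := e1 (p + Y.length) (by omega) hp'
    rw [show p + Y.length - X.length = p - X.length + Y.length by omega] at h2
    exact Option.some.inj (h1.trans (key.trans h2.symm))
  · rintro ⟨l, hl, hkl, h⟩
    obtain ⟨c, rfl⟩ := Nat.exists_eq_add_of_le' hkl
    refine ⟨(List.range c).map a, (List.range l).map (fun i => a (c + i)), ?_, ?_⟩
    · simpa using hl.ne'
    · rw [← map_range_eq_flatten_replicate, List.range_add, List.map_append, List.map_map]
      · rfl
      · intro i hi
        rw [h (c + i) (by omega) (by omega), add_assoc]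

theorem le_curl_iff (a : ℕ → ℕ) (E : ℕ) {k : ℕ} (hk : 2 ≤ k) :
    k ≤ curl ((List.range E).map a) ↔ ∃ l, PowerSuffix a E k l := by
  have hset : {k | ∃ X Y : List ℕ, Y ≠ [] ∧
      (List.range E).map a = X ++ (List.replicate k Y).flatten} =
      {k | ∃ l, PowerSuffix a E k l} := Set.ext fun k => eq_append_power_iff a E k
  have hbdd : BddAbove {k | ∃ l, PowerSuffix a E k l} := by
    refine ⟨E, ?_⟩
    rintro k ⟨l, hl, hkl, -⟩
    exact (Nat.le_mul_of_pos_right k hl).trans hkl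
  have hmem : sSup {k | ∃ l, PowerSuffix a E k l} ∈ {k | ∃ l, PowerSuffix a E k l} :=
    Nat.sSup_mem ⟨0, 1, by simp, by simp, fun p h1 h2 => by omega⟩ hbdd
  rw [curl, hset]
  constructor
  · intro h
    obtain ⟨l, hl, hkl, hp⟩ := hmem
    have hle : k ≤ sSup {k | ∃ l, PowerSuffix a E k l} := by
      rcases le_max_iff.1 h with h | h <;> omega
    have := Nat.mul_le_mul_right l hle
    exact ⟨l, hl, by omega, fun p h1 h2 => hp p (by omega) h2⟩
  · intro h
    exact (le_csSup hbdd h).trans (le_max_right _ _)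

theorem gPrefix_eq_map (m n : ℕ) :
    gPrefix m n = (List.range n).map fun p => max m (curl (gPrefix m p)) := by
  induction n with
  | zero => rfl
  | succ n ih => rw [List.range_succ, List.map_append, ← ih]; rfl

theorem le_curl_gPrefix_iff (m E : ℕ) {k : ℕ} (hk : 2 ≤ k) :
    k ≤ curl (gPrefix m E) ↔
      ∃ l, PowerSuffix (fun p => max m (curl (gPrefix m p))) E k l := by
  rw [gPrefix_eq_map, le_curl_iff _ _ hk]

theorem one_le_curl (S : List ℕ) : 1 ≤ curl S := le_max_left _ _

theorem curl_nil : curl [] = 1 := by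
  refine le_antisymm (not_lt.1 fun h => ?_) (one_le_curl _)
  obtain ⟨l, hl, hkl, -⟩ := (le_curl_iff id 0 le_rfl).1 h
  omega

theorem count_gPrefix (m n : ℕ) :
    (gPrefix m n).count m = Nat.count (fun k => curl (gPrefix m k) ≤ m) n := by
  induction n with
  | zero => simp [gPrefix]
  | succ n ih =>
    rw [gPrefix, List.count_append, ih, Nat.count_succ]
    congr 1
    simp [List.count_singleton]

theorem count_range_le_iff {P : ℕ → ℕ} (hP : StrictMono P) (p n : ℕ) :
    Nat.count (· ∈ Set.range P) p ≤ n ↔ p ≤ P n := by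
  have hcount : ∀ n, Nat.count (· ∈ Set.range P) (P n) = n := by
    intro n
    rw [Nat.count_eq_card_filter_range]
    have : Finset.filter (· ∈ Set.range P) (Finset.range (P n)) =
        (Finset.range n).image P := by
      ext x
      simp only [Finset.mem_filter, Finset.mem_range, Finset.mem_image, Set.mem_range]
      constructor
      · rintro ⟨h, i, rfl⟩
        exact ⟨i, hP.lt_iff_lt.1 h, rfl⟩
      · rintro ⟨i, hi, rfl⟩
        exact ⟨hP hi, i, rfl⟩
    rw [this, Finset.card_image_of_injective _ hP.injective, Finset.card_range]
  constructor
  · intro h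
    by_contra! hlt
    have h1 := Nat.count_monotone (· ∈ Set.range P) (Nat.succ_le_of_lt hlt)
    rw [Nat.succ_eq_add_one, Nat.count_succ, hcount, if_pos ⟨n, rfl⟩] at h1
    omega
  · intro h
    exact (Nat.count_monotone _ h).trans (hcount n).le

theorem count_range_apply {P : ℕ → ℕ} (hP : StrictMono P) (n : ℕ) :
    Nat.count (· ∈ Set.range P) (P n) = n := by
  refine le_antisymm ((count_range_le_iff hP _ _).2 le_rfl) ?_
  exact hP.le_iff_le.1 ((count_range_le_iff hP _ _).1 le_rfl)

/-- If the set of values of `P` is `l`-periodic on a window, then translating by `l` there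
shifts the index of `P` by a fixed `r`. -/
theorem exists_index_shift {P : ℕ → ℕ} (hP : StrictMono P) {E k l K : ℕ}
    (hkl : k * l ≤ E) (hK : P K < E) (hK' : E ≤ P (K + 1)) (hwin : E ≤ P K + k * l)
    (hper : ∀ p, E ≤ p + k * l → p + l < E → (p ∈ Set.range P ↔ p + l ∈ Set.range P)) :
    ∃ r, 0 < r ∧ k * r ≤ K + 1 ∧ (∀ n, E ≤ P n + k * l ↔ K + 1 ≤ n + k * r) ∧
      ∀ n, K + 1 ≤ n + k * r → n + r ≤ K → P (n + r) = P n + l := by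
  obtain ⟨s, rfl⟩ := Nat.exists_eq_add_of_le' hkl
  set c : ℕ → ℕ := fun p => Nat.count (· ∈ Set.range P) p
  have hcle : ∀ p n, c p ≤ n ↔ p ≤ P n := count_range_le_iff hP
  have hcP : ∀ n, c (P n) = n := count_range_apply hP
  have hmono : Monotone c := Nat.count_monotone _
  obtain ⟨r, hr⟩ := Nat.exists_eq_add_of_le (hmono (Nat.le_add_right s l))
  have hstep : ∀ d, s + d + l ≤ s + k * l → c (s + d + l) = c (s + d) + r := by
    intro d
    induction d with
    | zero => intro _; simpa using hr
    | succ d ih =>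
      intro hd
      have h1 := ih (by omega)
      have h2 := hper (s + d) (by omega) (by omega)
      have e1 : c (s + (d + 1) + l) = c (s + d + l) + if s + d + l ∈ Set.range P then 1 else 0 := by
        rw [show s + (d + 1) + l = s + d + l + 1 by ring]
        exact Nat.count_succ _ _
      have e2 : c (s + (d + 1)) = c (s + d) + if s + d ∈ Set.range P then 1 else 0 :=
        Nat.count_succ _ _
      rw [e1, e2, h1]
      simp only [h2]
      omega
  have hmul : ∀ i, i ≤ k → c (s + i * l) = c s + i * r := by
    intro i
    induction i with
    | zero => simp
    | succ i ih =>
      intro hi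
      have := Nat.mul_le_mul_right l hi
      rw [Nat.succ_mul] at this
      rw [Nat.succ_mul, Nat.succ_mul, ← add_assoc, hstep (i * l) (by omega), ih (by omega)]
      ring
  have hcE : c (s + k * l) = K + 1 := by
    refine le_antisymm ((hcle _ _).2 hK') ?_
    by_contra! h
    have := (hcle (s + k * l) K).1 (by omega)
    omega
  have hck := hmul k le_rfl
  rw [hcE] at hck
  have hcs : c s ≤ K := (hcle _ _).2 (by omega)
  have hiff : ∀ n, s + k * l ≤ P n + k * l ↔ K + 1 ≤ n + k * r := by
    intro n
    rw [Nat.add_le_add_iff_right, ← hcle]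
    omega
  refine ⟨r, ?_, by omega, hiff, ?_⟩
  · rcases Nat.eq_zero_or_pos r with rfl | h
    · omega
    · exact h
  · intro n h1 h2
    have hs := (hiff n).2 h1
    obtain ⟨d, hd⟩ := Nat.exists_eq_add_of_le (show s ≤ P n by omega)
    have hlt : P n + l < s + k * l := by
      by_contra! hge
      have hk1 : 1 ≤ k := by
        rcases Nat.eq_zero_or_pos k with rfl | h
        · omega
        · exact h
      obtain ⟨k', rfl⟩ := Nat.exists_eq_add_of_le' hk1
      have h3 := hmul k' (by omega)
      have h4 : c (s + k' * l) ≤ n := (hcle _ _).2 (by rw [Nat.succ_mul] at hge; omega)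
      rw [Nat.succ_mul] at hck
      omega
    obtain ⟨n', hn'⟩ := (hper (P n) hs hlt).1 ⟨n, rfl⟩
    have h5 := hstep d (by omega)
    rw [← hd, ← hn', hcP, hcP] at h5
    rw [← hn', h5]

/-- The starting position of block `n + 1`, when block `i` consists of one marked letter
followed by `L (multiplicity b i)` unmarked ones. -/
noncomputable def blockStart (b : ℕ) (L : ℕ → ℕ) (n : ℕ) : ℕ :=
  ∑ i ∈ Finset.range n, (1 + L (multiplicity b (i + 1)))

theorem blockStart_zero (b : ℕ) (L : ℕ → ℕ) : blockStart b L 0 = 0 := rfl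

theorem blockStart_succ (b : ℕ) (L : ℕ → ℕ) (n : ℕ) :
    blockStart b L (n + 1) = blockStart b L n + 1 + L (multiplicity b (n + 1)) := by
  rw [blockStart, Finset.sum_range_succ, ← add_assoc]; rfl

theorem blockStart_strictMono (b : ℕ) (L : ℕ → ℕ) : StrictMono (blockStart b L) :=
  strictMono_nat_of_lt_succ fun n => by rw [blockStart_succ]; omega

theorem exists_eq_blockStart (b : ℕ) (L : ℕ → ℕ) (p : ℕ) :
    ∃ n, p = blockStart b L n ∨
      ∃ i, i < L (multiplicity b (n + 1)) ∧ p = blockStart b L n + 1 + i := by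
  induction p with
  | zero => exact ⟨0, Or.inl rfl⟩
  | succ p ih =>
    obtain ⟨n, rfl | ⟨i, hi, rfl⟩⟩ := ih
    · by_cases h : L (multiplicity b (n + 1)) = 0
      · exact ⟨n + 1, Or.inl (by rw [blockStart_succ, h])⟩
      · exact ⟨n, Or.inr ⟨0, by omega, rfl⟩⟩
    · by_cases h : i + 1 < L (multiplicity b (n + 1))
      · exact ⟨n, Or.inr ⟨i + 1, h, rfl⟩⟩
      · exact ⟨n + 1, Or.inl (by rw [blockStart_succ]; omega)⟩

theorem blockStart_add_notMem_range (b : ℕ) (L : ℕ → ℕ) {n i : ℕ}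
    (hi : i < L (multiplicity b (n + 1))) :
    blockStart b L n + 1 + i ∉ Set.range (blockStart b L) := by
  rintro ⟨n', h⟩
  have hP := blockStart_strictMono b L
  have h1 : n < n' := hP.lt_iff_lt.1 (by omega)
  have h2 : n' < n + 1 := hP.lt_iff_lt.1 (by rw [blockStart_succ]; omega)
  omega

/-- Below position `E`, the word `a` is the concatenation of the blocks
`m, d 0, …, d (L (multiplicity b i) - 1)` for `i = 1, 2, …`. -/
structure IsBlockWord (b : ℕ) (L : ℕ → ℕ) (m : ℕ) (d a : ℕ → ℕ) (E : ℕ) : Prop where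
  start : ∀ n, blockStart b L n < E → a (blockStart b L n) = m
  inner : ∀ n i, i < L (multiplicity b (n + 1)) → blockStart b L n + 1 + i < E →
    a (blockStart b L n + 1 + i) = d i

theorem IsBlockWord.mem_range_iff {b : ℕ} {L : ℕ → ℕ} {m : ℕ} {d a : ℕ → ℕ} {E : ℕ}
    (h : IsBlockWord b L m d a E) (hd : ∀ i, m < d i) {p : ℕ} (hp : p < E) :
    p ∈ Set.range (blockStart b L) ↔ a p = m := by
  obtain ⟨n, rfl | ⟨i, hi, rfl⟩⟩ := exists_eq_blockStart b L p
  · simp [h.start n hp]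
  · have := hd i
    simp only [blockStart_add_notMem_range b L hi, h.inner n i hi hp, false_iff]
    omega

theorem pow_dvd_iff_le_multiplicity {b n : ℕ} (hb : 2 ≤ b) (hn : 0 < n) (k : ℕ) :
    b ^ k ∣ n ↔ k ≤ multiplicity b n :=
  (Nat.finiteMultiplicity_iff.2 ⟨by omega, hn⟩).pow_dvd_iff_le_multiplicity

theorem multiplicity_ne_add {b x r : ℕ} (hb : 2 ≤ b) (hx : 0 < x) (hr : 0 < r)
    (h : b ^ (multiplicity b r + 1) ∣ x ∨ b ^ (multiplicity b r + 1) ∣ x + r) :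
    multiplicity b x ≠ multiplicity b (x + r) := by
  intro heq
  have hiff : b ^ (multiplicity b r + 1) ∣ x ↔ b ^ (multiplicity b r + 1) ∣ x + r := by
    rw [pow_dvd_iff_le_multiplicity hb hx, pow_dvd_iff_le_multiplicity hb (by omega), heq]
  have hx' : b ^ (multiplicity b r + 1) ∣ x := h.elim id hiff.2
  have := (pow_dvd_iff_le_multiplicity hb hr _).1 ((Nat.dvd_add_right hx').1 (hiff.1 hx'))
  omega

theorem multiplicity_eq_of_pow_succ_dvd_add {b x r : ℕ} (hb : 2 ≤ b) (hx : 0 < x) (hr : 0 < r)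
    (h : b ^ (multiplicity b r + 1) ∣ x + r) : multiplicity b x = multiplicity b r := by
  refine le_antisymm ?_ ?_
  · by_contra! hlt
    have := (pow_dvd_iff_le_multiplicity hb hr _).1
      ((Nat.dvd_add_right ((pow_dvd_iff_le_multiplicity hb hx _).2 hlt)).1 h)
    omega
  · rw [← pow_dvd_iff_le_multiplicity hb hx]
    exact (Nat.dvd_add_left ((pow_dvd_iff_le_multiplicity hb hr _).2 le_rfl)).1
      ((pow_dvd_pow b (Nat.le_succ _)).trans h)

theorem multiplicity_add_pow {b x e : ℕ} (hb : 2 ≤ b) (hx : 0 < x)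
    (h1 : ¬ b ^ (e + 1) ∣ x) (h2 : ¬ b ^ (e + 1) ∣ x + b ^ e) :
    multiplicity b (x + b ^ e) = multiplicity b x := by
  have hpos : 0 < x + b ^ e := by omega
  have hiff : ∀ k, k ≤ e → (k ≤ multiplicity b (x + b ^ e) ↔ k ≤ multiplicity b x) := by
    intro k hk
    rw [← pow_dvd_iff_le_multiplicity hb hpos, ← pow_dvd_iff_le_multiplicity hb hx,
      Nat.dvd_add_left (pow_dvd_pow b hk)]
  rw [pow_dvd_iff_le_multiplicity hb hx] at h1
  rw [pow_dvd_iff_le_multiplicity hb hpos] at h2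
  have h3 := (hiff _ (show multiplicity b x ≤ e by omega)).2 le_rfl
  have h4 := (hiff _ (show multiplicity b (x + b ^ e) ≤ e by omega)).1 le_rfl
  omega

theorem not_pow_dvd_of_multiplicity_periodic {b k r N : ℕ} (hb : 2 ≤ b) (hk : 2 ≤ k) (hr : 0 < r)
    (hkr : k * r ≤ N)
    (hper : ∀ x, N < x + k * r → x + r < N → multiplicity b x = multiplicity b (x + r))
    (hk2 : k = 2 → ∀ x, x + r = N → ¬ b ∣ x) {x : ℕ} (hx : N < x + k * r) (hxN : x < N) :
    ¬ b ^ (multiplicity b r + 1) ∣ x := by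
  intro hdvd
  obtain ⟨k, rfl⟩ := Nat.exists_eq_add_of_le' hk
  have hmul : (k + 2) * r = k * r + r + r := by ring
  by_cases h : N < x - r + (k + 2) * r ∧ r < x
  · obtain ⟨y, rfl⟩ := Nat.exists_eq_add_of_le' h.2.le
    exact multiplicity_ne_add hb (by omega) hr (Or.inr hdvd) (hper y (by omega) hxN)
  · by_cases h' : x + r < N
    · exact multiplicity_ne_add hb (by omega) hr (Or.inl hdvd) (hper x hx h')
    · have hk0 : k = 0 := by
        by_contra hk0
        have := Nat.mul_le_mul_right r (Nat.one_le_iff_ne_zero.2 hk0)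
        omega
      subst hk0
      exact hk2 rfl x (by omega) ((dvd_pow_self b (Nat.succ_ne_zero _)).trans hdvd)

/-- A power suffix of a block word which reaches into the marked letters comes from a
period `r` of the block types. -/
theorem PowerSuffix.exists_period {b : ℕ} {L : ℕ → ℕ} {m : ℕ} {d a : ℕ → ℕ} {E k l K j : ℕ}
    (hb : 2 ≤ b) (hL : StrictMono L) (hL0 : L 0 = 0) (hd : ∀ i, m < d i)
    (hw : IsBlockWord b L m d a E) (hE : E = blockStart b L K + 1 + j)
    (hj : j ≤ L (multiplicity b (K + 1))) (hk : 2 ≤ k) (hs : PowerSuffix a E k l)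
    (hjk : j < k * l) :
    ∃ r, 0 < r ∧ k * r ≤ K + 1 ∧
      (∀ x, K + 1 < x + k * r → x + r < K + 1 → multiplicity b x = multiplicity b (x + r)) ∧
      (∀ x, x + r = K + 1 → j ≤ L (multiplicity b x)) ∧
      (k = 2 → j = 0 → ¬ b ∣ K + 1 → ∀ x, x + r = K + 1 → ¬ b ∣ x) := by
  obtain ⟨hl, hkl, hper⟩ := hs
  have hP := blockStart_strictMono b L
  have hper' : ∀ p, E ≤ p + k * l → p + l < E →
      (p ∈ Set.range (blockStart b L) ↔ p + l ∈ Set.range (blockStart b L)) := by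
    intro p h1 h2
    rw [hw.mem_range_iff hd (by omega), hw.mem_range_iff hd h2, hper p h1 h2]
  have hK1 := blockStart_succ b L K
  obtain ⟨r, hr, hkr, hwin, hshift⟩ :=
    exists_index_shift (K := K) hP hkl (by omega) (by omega) (by omega) hper'
  have h2r : 2 * r ≤ k * r := Nat.mul_le_mul_right r hk
  refine ⟨r, hr, hkr, ?_, ?_, ?_⟩
  · intro x hx hxr
    obtain ⟨n, rfl⟩ := Nat.exists_eq_add_of_le' (show 1 ≤ x by omega)
    have h1 := hshift n (by omega) (by omega)
    have h2 := hshift (n + 1) (by omega) (by omega)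
    rw [show n + 1 + r = n + r + 1 by ring, blockStart_succ, blockStart_succ] at h2
    have h3 := hL.injective (show L (multiplicity b (n + 1)) = L (multiplicity b (n + r + 1)) by omega)
    rw [h3, show n + r + 1 = n + 1 + r by ring]
  · intro x hx
    by_contra! hlt
    obtain ⟨n, rfl⟩ := Nat.exists_eq_add_of_le' (show 1 ≤ x by omega)
    have h1 := hshift n (by omega) (by omega)
    rw [show n + r = K by omega] at h1
    have h2 := (hwin (n + 1)).2 (by omega)
    have h3 := blockStart_succ b L n
    have h4 := (hper' _ h2 (by omega)).1 ⟨n + 1, rfl⟩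
    rw [h3, show blockStart b L n + 1 + L (multiplicity b (n + 1)) + l =
      blockStart b L K + 1 + L (multiplicity b (n + 1)) by omega] at h4
    exact blockStart_add_notMem_range b L (by omega) h4
  · rintro rfl rfl hN x hx hbx
    obtain ⟨n, rfl⟩ := Nat.exists_eq_add_of_le' (show 1 ≤ x by omega)
    have h1 := hshift n (by omega) (by omega)
    rw [show n + r = K by omega] at h1
    have hv : 1 ≤ multiplicity b (n + 1) := by
      rw [← pow_dvd_iff_le_multiplicity hb (by omega)]; simpa using hbx
    have hLpos : 0 < L (multiplicity b (n + 1)) := by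
      rw [← hL0]; exact hL hv
    have h2 := blockStart_add_notMem_range b L hLpos
    have hnot : E - 2 * l ∉ Set.range (blockStart b L) := by
      rwa [hper' _ (by omega) (by omega),
        show E - 2 * l + l = blockStart b L n + 1 + 0 by omega]
    apply hnot
    rcases Nat.eq_zero_or_pos (K + 1 - 2 * r) with h0 | h0
    · have := (hwin 0).2 (by omega)
      rw [blockStart_zero] at this
      exact ⟨0, by rw [blockStart_zero]; omega⟩
    · obtain ⟨n', hn'⟩ := Nat.exists_eq_add_of_le' h0
      have hndvd : ¬ b ∣ n' + 1 := by
        intro h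
        have hbr : b ∣ r := (Nat.dvd_add_right h).1 (by
          rw [show n' + 1 + r = n + 1 by omega]; exact hbx)
        exact hN (hx ▸ dvd_add hbx hbr)
      have hv0 : multiplicity b (n' + 1) = 0 := multiplicity_eq_zero.2 hndvd
      have h3 := blockStart_succ b L n'
      rw [hv0, hL0] at h3
      have h4 := (hwin (n' + 1)).2 (by omega)
      have h5 := mt (hwin n').1 (by omega)
      exact ⟨n' + 1, by omega⟩

/-- A period of the block types yields a power suffix of a block word. -/
theorem IsBlockWord.powerSuffix {b : ℕ} {L : ℕ → ℕ} {m : ℕ} {d a : ℕ → ℕ} {E k r K j : ℕ}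
    (hw : IsBlockWord b L m d a E) (hE : E = blockStart b L K + 1 + j)
    (hj : j ≤ L (multiplicity b (K + 1))) (hk : 2 ≤ k) (hr : 0 < r) (hkr : k * r ≤ K + 1)
    (hper : ∀ x, K + 1 < x + k * r → x + r < K + 1 → multiplicity b x = multiplicity b (x + r))
    (hlast : ∀ x, x + r = K + 1 → j = L (multiplicity b x)) :
    ∃ l, PowerSuffix a E k l := by
  obtain ⟨s, hs⟩ := Nat.exists_eq_add_of_le' hkr
  obtain ⟨k, rfl⟩ := Nat.exists_eq_add_of_le' (show 1 ≤ k by omega)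
  have hP := blockStart_strictMono b L
  have hrk : r ≤ k * r := Nat.le_mul_of_pos_left r (by omega)
  rw [Nat.succ_mul] at hkr hs hper
  obtain ⟨l, hl⟩ := Nat.exists_eq_add_of_le (hP.monotone (Nat.le_add_right s r))
  have hlpos : 0 < l := by
    have := hP (show s < s + r by omega)
    omega
  have hshift : ∀ i, s + i + r ≤ K →
      blockStart b L (s + i + r) = blockStart b L (s + i) + l := by
    intro i
    induction i with
    | zero => intro _; simpa using hl
    | succ i ih =>
      intro hi
      have h1 := ih (by omega)
      have h2 := hper (s + i + 1) (by omega) (by omega)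
      rw [show s + (i + 1) + r = s + i + r + 1 by ring, show s + (i + 1) = s + i + 1 by ring,
        blockStart_succ, blockStart_succ, h1, h2, show s + i + 1 + r = s + i + r + 1 by ring]
      ring
  have hmul : ∀ i, i ≤ k → s + i * r + r ≤ K + 1 ∧
      blockStart b L (s + i * r) = blockStart b L s + i * l := by
    intro i
    induction i with
    | zero => intro _; simp; omega
    | succ i ih =>
      intro hi
      have h1 := ih (by omega)
      have h2 := Nat.mul_le_mul_right r hi
      rw [Nat.succ_mul] at h2
      have h3 := hshift (i * r) (by omega)
      rw [Nat.succ_mul, Nat.succ_mul, ← add_assoc, h3, h1.2]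
      exact ⟨by omega, by ring⟩
  obtain ⟨n, hn⟩ := Nat.exists_eq_add_of_le' (show 1 ≤ s + k * r by omega)
  have hend : blockStart b L (s + k * r) + l = E := by
    have h1 := hlast (n + 1) (by omega)
    have h2 := hshift (n - s) (by omega)
    rw [show s + (n - s) = n by omega, show n + r = K by omega] at h2
    rw [hn, blockStart_succ]
    omega
  have hkP := (hmul k le_rfl).2
  refine ⟨l, hlpos, by rw [Nat.succ_mul]; omega, fun p h1 h2 => ?_⟩
  rw [Nat.succ_mul] at h1
  have hlow : blockStart b L s ≤ p := by omega
  have hhigh : p < blockStart b L (s + k * r) := by omega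
  obtain ⟨n', rfl | ⟨i, hi, rfl⟩⟩ := exists_eq_blockStart b L p
  · have h3 : s ≤ n' := hP.le_iff_le.1 hlow
    have h4 : n' < s + k * r := hP.lt_iff_lt.1 hhigh
    have h5 := hshift (n' - s) (by omega)
    rw [show s + (n' - s) = n' by omega] at h5
    rw [hw.start n' (by omega), ← h5, hw.start _ (by omega)]
  · have h3 : s < n' + 1 := hP.lt_iff_lt.1 (by rw [blockStart_succ]; omega)
    have h4 : n' < s + k * r := hP.lt_iff_lt.1 (by omega)
    have h5 := hshift (n' - s) (by omega)
    rw [show s + (n' - s) = n' by omega] at h5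
    have h6 : i < L (multiplicity b (n' + r + 1)) := by
      by_cases h : n' + r = K
      · have := hlast (n' + 1) (by omega)
        rw [h]
        omega
      · have := hper (n' + 1) (by omega) (by omega)
        rw [show n' + r + 1 = n' + 1 + r by ring, ← this]
        exact hi
    have e : blockStart b L n' + 1 + i + l = blockStart b L (n' + r) + 1 + i := by omega
    rw [e] at h2 ⊢
    rw [hw.inner n' i hi (by omega), hw.inner _ i h6 h2]

/-- In a block word, a `k`-th power suffix with `k ≥ b` which reaches into the marked letters
has `k = b` and ends strictly inside a block. -/
theorem PowerSuffix.eq_and_lt {b : ℕ} {L : ℕ → ℕ} {m : ℕ} {d a : ℕ → ℕ} {E k l K j : ℕ}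
    (hb : 3 ≤ b) (hL : StrictMono L) (hL0 : L 0 = 0) (hd : ∀ i, m < d i)
    (hw : IsBlockWord b L m d a E) (hE : E = blockStart b L K + 1 + j)
    (hj : j ≤ L (multiplicity b (K + 1))) (hk : b ≤ k) (hs : PowerSuffix a E k l)
    (hjk : j < k * l) : k = b ∧ j < L (multiplicity b (K + 1)) := by
  obtain ⟨r, hr, hkr, hper, hlast, -⟩ :=
    hs.exists_period (by omega) hL hL0 hd hw hE hj (by omega) hjk
  have hnd : ∀ x, K + 1 < x + k * r → x < K + 1 → ¬ b ^ (multiplicity b r + 1) ∣ x :=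
    fun x => not_pow_dvd_of_multiplicity_periodic (by omega) (by omega) hr hkr hper
      (fun h => by omega)
  have hrr : b ^ multiplicity b r ≤ r :=
    Nat.le_of_dvd hr ((pow_dvd_iff_le_multiplicity (by omega) hr _).2 le_rfl)
  set q := b ^ (multiplicity b r + 1) with hq
  have hqr : q ≤ b * r := by
    rw [hq, pow_succ']; exact Nat.mul_le_mul_left b hrr
  have hqpos : 0 < q := by positivity
  have hbk : b * r ≤ k * r := Nat.mul_le_mul_right r hk
  have hdvd : q ∣ K + 1 := by
    have h1 := Nat.div_add_mod (K + 1) q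
    have h2 := Nat.mod_lt (K + 1) hqpos
    by_contra hnot
    have h3 : (K + 1) % q ≠ 0 := fun h => hnot (Nat.dvd_of_mod_eq_zero h)
    exact hnd (q * ((K + 1) / q)) (by omega) (by omega) (dvd_mul_right _ _)
  constructor
  · by_contra hne
    have h1 : (b + 1) * r ≤ k * r := Nat.mul_le_mul_right r (by omega)
    rw [Nat.succ_mul] at h1
    exact hnd (K + 1 - q) (by omega) (by omega) (Nat.dvd_sub hdvd dvd_rfl)
  · have h2 : 3 * r ≤ k * r := Nat.mul_le_mul_right r (by omega)
    have hx : K + 1 - r + r = K + 1 := by omega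
    have h3 := hlast _ hx
    rw [multiplicity_eq_of_pow_succ_dvd_add (by omega) (by omega) hr (by rw [hx]; exact hdvd)] at h3
    exact h3.trans_lt (hL ((pow_dvd_iff_le_multiplicity (by omega) (by omega) _).1 hdvd))

theorem IsBlockWord.powerSuffix_iff {b : ℕ} {L : ℕ → ℕ} {m : ℕ} {d a : ℕ → ℕ} {E k l K j : ℕ}
    (hw : IsBlockWord b L m d a E) (hE : E = blockStart b L K + 1 + j)
    (hj : j ≤ L (multiplicity b (K + 1))) (hkl : k * l ≤ j) :
    PowerSuffix a E k l ↔ PowerSuffix d j k l := by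
  have key : ∀ i, i < j → a (blockStart b L K + 1 + i) = d i :=
    fun i hi => hw.inner K i (by omega) (by omega)
  constructor
  · rintro ⟨hl, -, h⟩
    refine ⟨hl, hkl, fun p h1 h2 => ?_⟩
    rw [← key p (by omega), ← key _ h2, h _ (by omega) (by omega), add_assoc]
  · rintro ⟨hl, -, h⟩
    refine ⟨hl, by omega, fun p h1 h2 => ?_⟩
    obtain ⟨i, rfl⟩ := Nat.exists_eq_add_of_le (show blockStart b L K + 1 ≤ p by omega)
    rw [add_assoc _ i l, key i (by omega), key _ (by omega)]
    exact h i (by omega) (by omega)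

theorem tau_strictMono {m : ℕ} (hinf : {k | curl (gPrefix (m + 1) k) ≤ m}.Infinite) :
    StrictMono fun i => tau m (i + 1) :=
  Nat.nth_strictMono hinf

theorem curl_gPrefix_tau {m : ℕ} (hinf : {k | curl (gPrefix (m + 1) k) ≤ m}.Infinite) (t : ℕ) :
    curl (gPrefix (m + 1) (tau m t)) ≤ m :=
  Nat.nth_mem_of_infinite hinf _

theorem exists_eq_tau {m k : ℕ} (hk : curl (gPrefix (m + 1) k) ≤ m) :
    ∃ i, tau m (i + 1) = k :=
  ⟨_, Nat.nth_count (p := fun k => curl (gPrefix (m + 1) k) ≤ m) hk⟩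

theorem tau_one {m : ℕ} (hm : 1 ≤ m) : tau m 1 = 0 := by
  have h : curl (gPrefix (m + 1) 0) ≤ m := by rw [gPrefix, curl_nil]; exact hm
  exact Nat.nth_zero_of_zero h

/-- The level-`m` sequence is the concatenation over `i = 1, 2, …` of the blocks consisting of
`m` and `T_{v+1}^(m)`, where `v` is the largest exponent with `(m+1)^v ∣ i`. -/
theorem isBlockWord_gPrefix {m : ℕ} (hm : 2 ≤ m)
    (hinf : {k | curl (gPrefix (m + 1) k) ≤ m}.Infinite) (E : ℕ) :
    IsBlockWord (m + 1) (fun i => tau m (i + 1)) m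
      (fun p => max (m + 1) (curl (gPrefix (m + 1) p)))
      (fun p => max m (curl (gPrefix m p))) E := by
  set L : ℕ → ℕ := fun i => tau m (i + 1)
  set d : ℕ → ℕ := fun p => max (m + 1) (curl (gPrefix (m + 1) p))
  set a : ℕ → ℕ := fun p => max m (curl (gPrefix m p))
  have hL : StrictMono L := tau_strictMono hinf
  have hL0 : L 0 = 0 := tau_one (by omega)
  have hd : ∀ i, m < d i := fun i => Nat.lt_of_succ_le (le_max_left _ _)
  induction E with
  | zero => exact ⟨fun n h => by omega, fun n i hi h => by omega⟩
  | succ E ih =>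
    refine ⟨fun n hn => ?_, fun n i hi hn => ?_⟩
    · rcases Nat.lt_succ_iff_lt_or_eq.1 hn with hlt | heq
      · exact ih.start n hlt
      · rw [heq]
        refine max_eq_left ?_
        obtain _ | K := n
        · rw [← heq, blockStart_zero, gPrefix, curl_nil]; omega
        · rw [blockStart_succ] at heq
          by_contra! hlt
          obtain ⟨l, hl⟩ := (le_curl_gPrefix_iff m E (by omega)).1 hlt
          rcases le_or_gt ((m + 1) * l) (L (multiplicity (m + 1) (K + 1))) with hle | hgt
          · have h1 := (le_curl_gPrefix_iff (m + 1) _ (by omega)).2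
              ⟨l, (ih.powerSuffix_iff heq.symm le_rfl hle).1 hl⟩
            have h2 := curl_gPrefix_tau hinf (multiplicity (m + 1) (K + 1) + 1)
            exact absurd (h1.trans h2) (by omega)
          · exact lt_irrefl _ (hl.eq_and_lt (by omega) hL hL0 hd ih heq.symm le_rfl le_rfl hgt).2
    · rcases Nat.lt_succ_iff_lt_or_eq.1 hn with hlt | heq
      · exact ih.inner n i hi hlt
      · rw [heq]
        refine le_antisymm (max_le ((hd i).le) ?_) (max_le ?_ ?_)
        · by_contra! hlt
          have hk : m + 1 < curl (gPrefix m E) := (le_max_left _ _).trans_lt hlt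
          obtain ⟨l, hl⟩ := (le_curl_gPrefix_iff m E (show 2 ≤ curl (gPrefix m E) by omega)).1 le_rfl
          rcases le_or_gt (curl (gPrefix m E) * l) i with hle | hgt
          · have h1 := (le_curl_gPrefix_iff (m + 1) _ (by omega)).2
              ⟨l, (ih.powerSuffix_iff heq.symm hi.le hle).1 hl⟩
            exact absurd (h1.trans (le_max_right _ _)) (by exact not_le.2 hlt)
          · have := (hl.eq_and_lt (by omega) hL hL0 hd ih heq.symm hi.le hk.le hgt).1
            omega
        · refine le_trans ?_ (le_max_right _ _)
          rw [le_curl_gPrefix_iff m E (by omega)]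
          by_cases hc : m + 1 ≤ curl (gPrefix (m + 1) i)
          · obtain ⟨l, hl⟩ := (le_curl_gPrefix_iff (m + 1) i (by omega)).1 hc
            exact ⟨l, (ih.powerSuffix_iff heq.symm hi.le hl.2.1).2 hl⟩
          · obtain ⟨e, he⟩ := exists_eq_tau (show curl (gPrefix (m + 1) i) ≤ m by omega)
            have hev : e < multiplicity (m + 1) (n + 1) := hL.lt_iff_lt.1 (by
              show tau m (e + 1) < _
              rw [he]; exact hi)
            have hdvd : (m + 1) ^ (e + 1) ∣ n + 1 :=
              (pow_dvd_iff_le_multiplicity (by omega) (by omega) _).2 hev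
            have hle := Nat.le_of_dvd (by omega) hdvd
            have hpos : 0 < (m + 1) ^ e := by positivity
            have hself : multiplicity (m + 1) ((m + 1) ^ e) = e :=
              multiplicity_pow_self (by omega) (by rw [Nat.isUnit_iff]; omega) e
            refine ih.powerSuffix heq.symm hi.le (by omega) hpos (by rwa [← pow_succ']) ?_ ?_
            · intro x hx hx'
              rw [← pow_succ'] at hx
              have hx0 : 0 < x := by omega
              have hbig : ∀ y, n + 1 < y + (m + 1) ^ (e + 1) → y < n + 1 →
                  ¬ (m + 1) ^ (e + 1) ∣ y := by
                intro y h1 h2 h3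
                have := Nat.le_of_dvd (by omega) (Nat.dvd_sub hdvd h3)
                omega
              exact (multiplicity_add_pow (by omega) hx0 (hbig x hx (by omega))
                (hbig _ (by omega) hx')).symm
            · intro x hx
              have h3 : 2 * (m + 1) ^ e ≤ (m + 1) * (m + 1) ^ e :=
                Nat.mul_le_mul_right _ (by omega)
              rw [← pow_succ'] at h3
              rw [multiplicity_eq_of_pow_succ_dvd_add (by omega) (by omega) hpos
                (by rw [hself, hx]; exact hdvd), hself]
              exact he.symm
        · by_cases hc : 2 ≤ curl (gPrefix (m + 1) i)
          · obtain ⟨l, hl⟩ := (le_curl_gPrefix_iff (m + 1) i hc).1 le_rfl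
            exact ((le_curl_gPrefix_iff m E hc).2
              ⟨l, (ih.powerSuffix_iff heq.symm hi.le hl.2.1).2 hl⟩).trans (le_max_right _ _)
          · exact le_trans (by omega) (le_max_left _ _)

theorem curl_gPrefix_le_eq_mem_range {m : ℕ} (hm : 2 ≤ m)
    (hinf : {k | curl (gPrefix (m + 1) k) ≤ m}.Infinite) :
    (fun k => curl (gPrefix m k) ≤ m) =
      (· ∈ Set.range (blockStart (m + 1) fun i => tau m (i + 1))) := by
  ext p
  rw [(isBlockWord_gPrefix hm hinf (p + 1)).mem_range_iff
    (fun i => Nat.lt_of_succ_le (le_max_left _ _)) (Nat.lt_succ_self p), max_eq_left_iff]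

theorem piLen_eq_blockStart {m : ℕ} (hm : 2 ≤ m)
    (hinf : {k | curl (gPrefix (m + 1) k) ≤ m}.Infinite) (y : ℕ) :
    piLen m y = blockStart (m + 1) (fun i => tau m (i + 1)) y := by
  rw [piLen, curl_gPrefix_le_eq_mem_range hm hinf]
  set P := blockStart (m + 1) fun i => tau m (i + 1)
  conv_lhs => rw [← count_range_apply (P := P) (blockStart_strictMono _ _) y]
  exact Nat.nth_count (p := (· ∈ Set.range P)) ⟨y, rfl⟩

theorem maxdigit_le_iff {b n c : ℕ} (hb : 2 ≤ b) :
    maxdigit b n ≤ c ↔ ∀ e, n / b ^ e % b ≤ c := by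
  have hfold : ∀ l : List ℕ, l.foldr max 0 ≤ c ↔ ∀ e, l.getD e 0 ≤ c := by
    intro l
    induction l with
    | nil => simp
    | cons x l ih =>
      rw [List.foldr_cons, max_le_iff, ih]
      constructor
      · rintro ⟨h1, h2⟩ (_ | e)
        · simpa using h1
        · simpa using h2 e
      · intro h
        exact ⟨by simpa using h 0, fun e => by simpa using h (e + 1)⟩
  rw [maxdigit, hfold]
  simp only [Nat.getD_digits _ _ hb]

/-- If `y` has a base-`(m+1)` digit equal to `m`, then `π^(m)(1,y)` has curling number at
least `m`. -/
theorem le_curl_piStr {m : ℕ} (hm : 2 ≤ m)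
    (hinf : {k | curl (gPrefix (m + 1) k) ≤ m}.Infinite) {y e : ℕ}
    (hy : y / (m + 1) ^ e % (m + 1) = m) : m ≤ curl (piStr m y) := by
  have hpos : 0 < (m + 1) ^ e := by positivity
  obtain ⟨q, s, hs, hy'⟩ : ∃ q s, s < (m + 1) ^ e ∧
      y = (m + 1) ^ (e + 1) * q + m * (m + 1) ^ e + s := by
    refine ⟨y / (m + 1) ^ e / (m + 1), y % (m + 1) ^ e, Nat.mod_lt y hpos, ?_⟩
    have h1 := Nat.div_add_mod y ((m + 1) ^ e)
    have h2 := Nat.div_add_mod (y / (m + 1) ^ e) (m + 1)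
    rw [hy] at h2
    conv_lhs => rw [← h1, ← h2]
    ring
  have hpow : (m + 1) ^ (e + 1) = m * (m + 1) ^ e + (m + 1) ^ e := by ring
  have h2m : 2 * (m + 1) ^ e ≤ m * (m + 1) ^ e := Nat.mul_le_mul_right _ hm
  have hndvd : ∀ x, y < x + m * (m + 1) ^ e → x ≤ y → ¬ (m + 1) ^ (e + 1) ∣ x := by
    intro x hx hxy hdvd
    have := Nat.le_of_dvd (by omega) ((Nat.dvd_sub hdvd (dvd_mul_right ((m + 1) ^ (e + 1)) q)))
    omega
  have hper : ∀ x, y < x + m * (m + 1) ^ e → x + (m + 1) ^ e ≤ y →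
      multiplicity (m + 1) x = multiplicity (m + 1) (x + (m + 1) ^ e) := fun x hx hx' =>
    (multiplicity_add_pow (by omega) (by omega) (hndvd x hx (by omega))
      (hndvd _ (by omega) hx')).symm
  obtain ⟨K, rfl⟩ := Nat.exists_eq_add_of_le' (show 1 ≤ y by omega)
  rw [piStr, piLen_eq_blockStart hm hinf, le_curl_gPrefix_iff m _ hm]
  refine (isBlockWord_gPrefix hm hinf _).powerSuffix (blockStart_succ _ _ _) le_rfl hm hpos
    (by omega) (fun x hx hx' => hper x hx hx'.le) fun x hx => ?_
  rw [hper x (by omega) hx.le, hx]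

/-- If `y` is not divisible by `m + 1` and has no base-`(m+1)` digit equal to `m`, then
`π^(m)(1,y)` has curling number less than `m`. -/
theorem curl_piStr_lt {m : ℕ} (hm : 2 ≤ m)
    (hinf : {k | curl (gPrefix (m + 1) k) ≤ m}.Infinite) {y : ℕ} (hy : ¬ (m + 1) ∣ y)
    (hdig : ∀ e, y / (m + 1) ^ e % (m + 1) < m) : curl (piStr m y) < m := by
  by_contra! hle
  have hb : 2 ≤ m + 1 := by omega
  obtain ⟨K, rfl⟩ := Nat.exists_eq_add_of_le' (show 1 ≤ y by
    rcases Nat.eq_zero_or_pos y with rfl | h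
    · simp at hy
    · exact h)
  have hL0 : tau m (0 + 1) = 0 := tau_one (by omega)
  rw [piStr, piLen_eq_blockStart hm hinf, le_curl_gPrefix_iff m _ hm] at hle
  obtain ⟨l, hl⟩ := hle
  have hv : multiplicity (m + 1) (K + 1) = 0 := multiplicity_eq_zero.2 hy
  have hE := blockStart_succ (m + 1) (fun i => tau m (i + 1)) K
  rw [hv, hL0] at hE
  obtain ⟨r, hr, hkr, hper, -, h2⟩ := hl.exists_period hb (tau_strictMono hinf) hL0
    (fun i => Nat.lt_of_succ_le (le_max_left _ _)) (isBlockWord_gPrefix hm hinf _) hE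
    (Nat.zero_le _) hm (Nat.mul_pos (by omega) hl.1)
  have hnd : ∀ x, K + 1 < x + m * r → x ≤ K + 1 →
      ¬ (m + 1) ^ (multiplicity (m + 1) r + 1) ∣ x := by
    intro x hx hx'
    rcases hx'.lt_or_eq with h | rfl
    · exact not_pow_dvd_of_multiplicity_periodic hb hm hr hkr hper (fun h => h2 h rfl hy) hx h
    · exact fun h => hy ((dvd_pow_self _ (Nat.succ_ne_zero _)).trans h)
  set e := multiplicity (m + 1) r
  have hrr : (m + 1) ^ e ≤ r :=
    Nat.le_of_dvd hr ((pow_dvd_iff_le_multiplicity hb hr _).2 le_rfl)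
  have hmod : m * (m + 1) ^ e ≤ (K + 1) % (m + 1) ^ (e + 1) := by
    by_contra! hlt
    have h3 := Nat.mod_add_div (K + 1) ((m + 1) ^ (e + 1))
    have h4 := Nat.mul_le_mul_left m hrr
    exact hnd _ (by linarith) (by linarith [Nat.zero_le ((K + 1) % (m + 1) ^ (e + 1))])
      (dvd_mul_right ((m + 1) ^ (e + 1)) ((K + 1) / (m + 1) ^ (e + 1)))
  refine absurd ((Nat.le_div_iff_mul_le (by positivity)).2 hmod) (not_le.2 ?_)
  rw [pow_succ, Nat.mod_mul_right_div_self]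
  exact hdig e

/-- characterization of the `T` strings. Let `m ≥ 2`. (1) For `t ≥ 2`,
every base-`(m+1)` digit of the number of `m`'s in `T_t^(m-1)` is at most `m-1`
(equivalently `T_t^(m-1)` is a product `(B_x^(m))^{a_x}·…·(B_1^(m))^{a_1}` with digits
`≤ m-1`, i.e. `T_t^(m-1) = π^(m)(1, y)` where `y` is that count). (2) Conversely every
`y ≥ 1` not divisible by `m+1` with all base-`(m+1)` digits `≤ m-1` arises this way. -/
theorem statement3 (hSH : StandingHyp) (m : ℕ) (hm : 2 ≤ m) :
    (∀ t : ℕ, 2 ≤ t →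
      maxdigit (m + 1) ((Tstr (m - 1) t).count m) ≤ m - 1 ∧
      Tstr (m - 1) t = piStr m ((Tstr (m - 1) t).count m)) ∧
    (∀ y : ℕ, 1 ≤ y → ¬(m + 1) ∣ y → maxdigit (m + 1) y ≤ m - 1 →
      ∃ t : ℕ, 2 ≤ t ∧ Tstr (m - 1) t = piStr m y) := by
  obtain ⟨c, rfl⟩ := Nat.exists_eq_add_of_le' (show 1 ≤ m by omega)
  rw [Nat.add_sub_cancel]
  have hinf := (hSH (c + 1) (by omega)).2
  have hinf' := (hSH c (by omega)).2
  have hpi : ∀ k, curl (gPrefix (c + 1) k) ≤ c + 1 →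
      gPrefix (c + 1) k = piStr (c + 1) ((gPrefix (c + 1) k).count (c + 1)) := by
    intro k hk
    rw [piStr, piLen, count_gPrefix,
      Nat.nth_count (p := fun k => curl (gPrefix (c + 1) k) ≤ c + 1) hk]
  constructor
  · intro t _
    have hcurl : curl (Tstr c t) ≤ c := curl_gPrefix_tau hinf' t
    have heq := hpi (tau c t) (hcurl.trans (Nat.le_succ c))
    refine ⟨?_, heq⟩
    rw [maxdigit_le_iff (by omega)]
    intro e
    by_contra! hlt
    have hmod := Nat.mod_lt ((Tstr c t).count (c + 1) / (c + 1 + 1) ^ e)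
      (show c + 1 + 1 > 0 by omega)
    have hge := le_curl_piStr hm hinf (y := (Tstr c t).count (c + 1)) (e := e) (by omega)
    have heq' : piStr (c + 1) ((Tstr c t).count (c + 1)) = Tstr c t := heq.symm
    rw [heq'] at hge
    omega
  · intro y hy hndvd hdig
    rw [maxdigit_le_iff (by omega)] at hdig
    have hcurl := curl_piStr_lt hm hinf hndvd fun e => Nat.lt_succ_of_le (hdig e)
    obtain ⟨i, hi⟩ := exists_eq_tau (show curl (gPrefix (c + 1) (piLen (c + 1) y)) ≤ c from
      Nat.le_of_lt_succ hcurl)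
    refine ⟨i + 1, ?_, by rw [Tstr, hi]; rfl⟩
    by_contra! hlt
    obtain rfl : i = 0 := by omega
    rw [zero_add, tau_one (by omega), piLen_eq_blockStart hm hinf,
      ← blockStart_zero (c + 1 + 1) fun i => tau (c + 1) (i + 1)] at hi
    have := (blockStart_strictMono _ _).injective hi
    omega
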